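/- Let N ≥ 1 be an integer, let u ∈ L^1_0(ℝ^N), and let φ ∈ C_c^D(ℝ^N). Then the limit lim_{t→0⁺} ∫_{ℝ^N} ( w_u(x,t) + u(x) ln t ) φ(x) dx exists and ∫_{ℝ^N} u(x) L_Δ φ(x) dx = 2 (ln 2 − γ) ∫_{ℝ^N} u(x) φ(x) dx − 2 lim_{t→0⁺} ∫_{ℝ^N} ( w_u(x,t) + u(x) ln t ) φ(x) dx. -/

import Mathlib

open MeasureTheory Real Filter Topology Set Metric

noncomputable section

/-- The normalization constant `c_N = Γ(N/2)/π^(N/2)`. -/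
def cN (N : ℕ) : ℝ := Real.Gamma ((N : ℝ) / 2) / Real.pi ^ ((N : ℝ) / 2)

/-- Membership in the space `L^1_0(ℝ^N)`. -/
def MemL10 (N : ℕ) (u : EuclideanSpace ℝ (Fin N) → ℝ) : Prop :=
  MeasureTheory.LocallyIntegrable u volume ∧
    MeasureTheory.Integrable (fun x => (1 + ‖x‖) ^ (-(N : ℝ)) * |u x|) volume

/-- The Poisson-type extension `w_u`. -/
def poissonExt (N : ℕ) (u : EuclideanSpace ℝ (Fin N) → ℝ)
    (x : EuclideanSpace ℝ (Fin N)) (t : ℝ) : ℝ :=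
  (cN N / 2) * ∫ y, u y * (‖x - y‖ ^ 2 + t ^ 2) ^ (-(N : ℝ) / 2)

/-- The digamma function `ψ = Γ'/Γ`. -/
def digammaFn (x : ℝ) : ℝ := deriv Real.Gamma x / Real.Gamma x

/-- The Euler–Mascheroni constant `γ = −Γ'(1)`. -/
def eulerGamma : ℝ := -(deriv Real.Gamma 1)

/-- The constant `ρ_N = 2 ln 2 + ψ(N/2) − γ`. -/
def rhoN (N : ℕ) : ℝ := 2 * Real.log 2 + digammaFn ((N : ℝ) / 2) - eulerGamma

theorem digammaFn_add_one {x : ℝ} (hx : 0 < x) : digammaFn (x + 1) = digammaFn x + 1 / x := by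
  have hd : DifferentiableAt ℝ Real.Gamma x :=
    Real.differentiableAt_Gamma fun m => by
      have : (0 : ℝ) ≤ m := m.cast_nonneg
      linarith
  have hG : Real.Gamma x ≠ 0 := (Real.Gamma_pos_of_pos hx).ne'
  have h1 : HasDerivAt (fun y => Real.Gamma (y + 1)) (deriv Real.Gamma (x + 1)) x := by
    have h := (Real.differentiableAt_Gamma (s := x + 1) fun m => by
      have : (0 : ℝ) ≤ m := m.cast_nonneg
      linarith).hasDerivAt
    exact h.comp_add_const x 1
  have h2 : HasDerivAt (fun y => y * Real.Gamma y) (1 * Real.Gamma x + x * deriv Real.Gamma x) x :=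
    (hasDerivAt_id x).mul hd.hasDerivAt
  have h3 : HasDerivAt (fun y => Real.Gamma (y + 1))
      (1 * Real.Gamma x + x * deriv Real.Gamma x) x := by
    refine h2.congr_of_eventuallyEq ?_
    filter_upwards [lt_mem_nhds hx] with y hy
    exact Real.Gamma_add_one hy.ne'
  unfold digammaFn
  rw [h1.unique h3, Real.Gamma_add_one hx.ne']
  field_simp
  ring

theorem digammaFn_one : digammaFn 1 = -eulerGamma := by
  simp [digammaFn, eulerGamma]

theorem digammaFn_one_half : digammaFn (1 / 2) = -eulerGamma - 2 * Real.log 2 := by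
  have hπ : √Real.pi ≠ 0 := (Real.sqrt_pos.mpr Real.pi_pos).ne'
  rw [digammaFn, Real.hasDerivAt_Gamma_one_half.deriv, Real.Gamma_one_half_eq, eulerGamma,
    Real.hasDerivAt_Gamma_one.deriv]
  field_simp
  ring

theorem tendsto_one_add_inv_sq_atTop : Tendsto (fun s : ℝ => 1 + (s ^ 2)⁻¹) atTop (𝓝 1) := by
  simpa using (tendsto_inv_atTop_zero.comp (tendsto_pow_atTop (α := ℝ) two_ne_zero)).const_add 1

/-- The antiderivative of the radial profile of the Poisson-type kernel vanishing at the origin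
grows like `log s`, up to an explicit constant. -/
theorem exists_radial_primitive (N : ℕ) : ∃ F : ℝ → ℝ, F 0 = 0 ∧
    (∀ s, HasDerivAt F (s ^ N * (1 + s ^ 2) ^ (-((N + 1 : ℕ) : ℝ) / 2)) s) ∧
    Tendsto (fun s => F s - Real.log s) atTop
      (𝓝 (-(eulerGamma + digammaFn (((N + 1 : ℕ) : ℝ) / 2)) / 2)) := by
  induction N using Nat.twoStepInduction with
  | zero =>
    refine ⟨Real.arsinh, Real.arsinh_zero, fun s => ?_, ?_⟩
    · convert Real.hasDerivAt_arsinh s using 1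
      rw [pow_zero, one_mul, Real.sqrt_eq_rpow, ← Real.rpow_neg (by positivity)]
      norm_num
    · have h : Tendsto (fun s : ℝ => Real.log (1 + √(1 + (s ^ 2)⁻¹))) atTop
          (𝓝 (Real.log (1 + √1))) :=
        Tendsto.log (tendsto_one_add_inv_sq_atTop.sqrt.const_add 1) (by norm_num)
      have e : -(eulerGamma + digammaFn (((0 + 1 : ℕ) : ℝ) / 2)) / 2 = Real.log (1 + √1) := by
        have := digammaFn_one_half
        norm_num at this ⊢
        rw [this]
        ring_nf
      rw [e]
      refine h.congr' ?_
      filter_upwards [eventually_gt_atTop 0] with s hs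
      rw [Real.arsinh, ← Real.log_div (by positivity) hs.ne']
      have : 1 + s ^ 2 = s ^ 2 * (1 + (s ^ 2)⁻¹) := by field_simp; ring
      rw [this, Real.sqrt_mul (by positivity), Real.sqrt_sq hs.le]
      congr 1
      field_simp
  | one =>
    refine ⟨fun s => Real.log (1 + s ^ 2) / 2, by simp, fun s => ?_, ?_⟩
    · have h1 : (0 : ℝ) < 1 + s ^ 2 := by positivity
      have h2 : HasDerivAt (fun s : ℝ => 1 + s ^ 2) (2 * s) s := by
        simpa using ((hasDerivAt_id s).pow 2).const_add 1
      refine ((h2.log h1.ne').div_const 2).congr_deriv ?_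
      norm_num [Real.rpow_neg_one]
      field_simp
    · have h : Tendsto (fun s : ℝ => Real.log (1 + (s ^ 2)⁻¹) / 2) atTop (𝓝 (Real.log 1 / 2)) :=
        (tendsto_one_add_inv_sq_atTop.log one_ne_zero).div_const 2
      have e : -(eulerGamma + digammaFn (((1 + 1 : ℕ) : ℝ) / 2)) / 2 = Real.log 1 / 2 := by
        have := digammaFn_one
        norm_num [this]
      rw [e]
      refine h.congr' ?_
      filter_upwards [eventually_gt_atTop 0] with s hs
      have : 1 + s ^ 2 = s ^ 2 * (1 + (s ^ 2)⁻¹) := by field_simp; ring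
      rw [this, Real.log_mul (by positivity) (by positivity), Real.log_pow]
      push_cast
      ring
  | more n ih _ =>
    obtain ⟨F, F0, hF, hlim⟩ := ih
    refine ⟨fun s => F s - s ^ (n + 1) * (1 + s ^ 2) ^ (-((n + 1 : ℕ) : ℝ) / 2) / (n + 1 : ℕ),
      by simp [F0], fun s => ?_, ?_⟩
    · have h1 : (0 : ℝ) < 1 + s ^ 2 := by positivity
      have h2 : HasDerivAt (fun s : ℝ => 1 + s ^ 2) (2 * s) s := by
        simpa using ((hasDerivAt_id s).pow 2).const_add 1
      have h3 := h2.rpow_const (p := -((n + 1 : ℕ) : ℝ) / 2) (Or.inl h1.ne')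
      have h4 := (hF s).sub (((hasDerivAt_pow (n + 1) s).mul h3).div_const ((n + 1 : ℕ) : ℝ))
      refine h4.congr_deriv ?_
      have e1 : -((n + 2 + 1 : ℕ) : ℝ) / 2 = -((n + 1 : ℕ) : ℝ) / 2 - 1 := by push_cast; ring
      have hn : ((n + 1 : ℕ) : ℝ) ≠ 0 := by positivity
      rw [e1, Nat.add_sub_cancel, Real.rpow_sub_one h1.ne']
      field_simp
      ring
    · have h : Tendsto (fun s : ℝ => (1 + (s ^ 2)⁻¹) ^ (-((n + 1 : ℕ) : ℝ) / 2)) atTop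
          (𝓝 (1 ^ (-((n + 1 : ℕ) : ℝ) / 2))) :=
        tendsto_one_add_inv_sq_atTop.rpow_const (Or.inl one_ne_zero)
      rw [Real.one_rpow] at h
      have e : -(eulerGamma + digammaFn (((n + 2 + 1 : ℕ) : ℝ) / 2)) / 2 =
          -(eulerGamma + digammaFn (((n + 1 : ℕ) : ℝ) / 2)) / 2 - 1 / (n + 1 : ℕ) := by
        have e2 : ((n + 2 + 1 : ℕ) : ℝ) / 2 = ((n + 1 : ℕ) : ℝ) / 2 + 1 := by push_cast; ring
        rw [e2, digammaFn_add_one (by positivity)]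
        field_simp
        ring
      rw [e]
      refine (hlim.sub (h.div_const ((n + 1 : ℕ) : ℝ))).congr' ?_
      filter_upwards [eventually_gt_atTop 0] with s hs
      have : 1 + s ^ 2 = s ^ 2 * (1 + (s ^ 2)⁻¹) := by field_simp; ring
      have e3 : (s ^ 2) ^ (-((n + 1 : ℕ) : ℝ) / 2) = (s ^ (n + 1))⁻¹ := by
        rw [← Real.rpow_natCast s 2, ← Real.rpow_mul hs.le, ← Real.rpow_natCast s (n + 1),
          ← Real.rpow_neg hs.le]
        congr 1
        push_cast
        ring
      rw [this, Real.mul_rpow (by positivity) (by positivity), e3]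
      field_simp
      ring

theorem cN_pos {N : ℕ} (hN : 1 ≤ N) : 0 < cN N := by
  have : (0 : ℝ) < N := by exact_mod_cast hN
  exact div_pos (Real.Gamma_pos_of_pos (by positivity)) (by positivity)

theorem cN_mul_volume_unit_ball {N : ℕ} (hN : 1 ≤ N) :
    cN N * (N * (volume : Measure (EuclideanSpace ℝ (Fin N))).real (ball 0 1)) = 2 := by
  have hN' : (0 : ℝ) < N := by exact_mod_cast hN
  have : Nonempty (Fin N) := ⟨⟨0, hN⟩⟩
  have hG : 0 < Real.Gamma ((N : ℝ) / 2) := Real.Gamma_pos_of_pos (by positivity)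
  have hπ : √Real.pi ^ N = Real.pi ^ ((N : ℝ) / 2) := by
    rw [Real.sqrt_eq_rpow, ← Real.rpow_natCast, ← Real.rpow_mul Real.pi_pos.le]
    congr 1
    ring
  rw [Measure.real, EuclideanSpace.volume_ball, Fintype.card_fin, ENNReal.ofReal_one, one_pow,
    one_mul, hπ, Real.Gamma_add_one (by positivity),
    ENNReal.toReal_ofReal (by positivity), cN]
  field_simp

theorem continuous_poissonKernel {N : ℕ} {t : ℝ} (ht : 0 < t) :
    Continuous fun y : EuclideanSpace ℝ (Fin N) => (‖y‖ ^ 2 + t ^ 2) ^ (-(N : ℝ) / 2) :=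
  Continuous.rpow_const (by fun_prop) fun y => Or.inl (by positivity)

theorem poissonKernel_le_of_le {N : ℕ} {a b t : ℝ} (ha : 0 < a) (hab : a ^ 2 ≤ b ^ 2 + t ^ 2) :
    (b ^ 2 + t ^ 2) ^ (-(N : ℝ) / 2) ≤ a ^ (-(N : ℝ)) := by
  have e : a ^ (-(N : ℝ)) = (a ^ 2) ^ (-(N : ℝ) / 2) := by
    rw [← Real.rpow_natCast a 2, ← Real.rpow_mul ha.le]
    congr 1
    push_cast
    ring
  rw [e]
  have : (0 : ℝ) ≤ N := N.cast_nonneg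
  exact Real.rpow_le_rpow_of_nonpos (by positivity) hab (by linarith)

theorem tendsto_integral_unit_ball_poissonKernel {N : ℕ} (hN : 1 ≤ N) :
    Tendsto (fun t : ℝ => cN N * (∫ y in ball (0 : EuclideanSpace ℝ (Fin N)) 1,
        (‖y‖ ^ 2 + t ^ 2) ^ (-(N : ℝ) / 2)) + 2 * Real.log t)
      (𝓝[>] 0) (𝓝 (-(eulerGamma + digammaFn ((N : ℝ) / 2)))) := by
  obtain ⟨M, rfl⟩ : ∃ M, N = M + 1 := ⟨N - 1, by omega⟩
  obtain ⟨F, F0, hF, hlim⟩ := exists_radial_primitive M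
  have key : ∀ t : ℝ, 0 < t → cN (M + 1) *
      (∫ y in ball (0 : EuclideanSpace ℝ (Fin (M + 1))) 1,
        (‖y‖ ^ 2 + t ^ 2) ^ (-((M + 1 : ℕ) : ℝ) / 2)) = 2 * F t⁻¹ := by
    intro t ht
    set k : ℝ → ℝ := fun r => (r ^ 2 + t ^ 2) ^ (-((M + 1 : ℕ) : ℝ) / 2) with hk
    have h1 : (∫ y in ball (0 : EuclideanSpace ℝ (Fin (M + 1))) 1, k ‖y‖) =
        ∫ y : EuclideanSpace ℝ (Fin (M + 1)), (Iio 1).indicator k ‖y‖ := by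
      rw [← integral_indicator measurableSet_ball]
      refine integral_congr_ae (.of_forall fun y => ?_)
      simp [indicator]
    have h2 : (∫ r in Ioi (0 : ℝ), r ^ M • (Iio 1).indicator k r) =
        ∫ r in (0 : ℝ)..1, r ^ M * k r := by
      have e : (fun r : ℝ => r ^ M • (Iio 1).indicator k r) =
          (Iio 1).indicator fun r => r ^ M * k r := by
        ext r
        simp [indicator]
      rw [e, setIntegral_indicator measurableSet_Iio, Ioi_inter_Iio,
        ← integral_Ioc_eq_integral_Ioo, intervalIntegral.integral_of_le zero_le_one]
    have h3 : (∫ r in (0 : ℝ)..1, r ^ M * k r) = F t⁻¹ := by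
      have hd : ∀ r ∈ uIcc (0 : ℝ) 1, HasDerivAt (fun r => F (r * t⁻¹)) (r ^ M * k r) r := by
        intro r _
        have h := (hF (r * t⁻¹)).comp r ((hasDerivAt_id r).mul_const t⁻¹)
        refine h.congr_deriv ?_
        have e1 : 1 + (r * t⁻¹) ^ 2 = (r ^ 2 + t ^ 2) * (t ^ 2)⁻¹ := by field_simp; ring
        have e2 : ((t ^ 2)⁻¹) ^ (-((M + 1 : ℕ) : ℝ) / 2) = t ^ (M + 1) := by
          rw [Real.inv_rpow (by positivity), ← Real.rpow_neg (by positivity),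
            ← Real.rpow_natCast t 2, ← Real.rpow_mul ht.le, ← Real.rpow_natCast t (M + 1)]
          congr 1
          push_cast
          ring
        rw [e1, Real.mul_rpow (by positivity) (by positivity), e2]
        simp only [hk, mul_pow, inv_pow]
        field_simp
        ring
      rw [intervalIntegral.integral_eq_sub_of_hasDerivAt hd]
      · simp [F0]
      · refine Continuous.intervalIntegrable ?_ _ _
        exact (continuous_pow M).mul
          (Continuous.rpow_const (by fun_prop) fun y => Or.inl (by positivity))
    have h4 := cN_mul_volume_unit_ball (N := M + 1) (by omega)
    rw [h1, integral_fun_norm_addHaar, finrank_euclideanSpace, Fintype.card_fin,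
      Nat.add_sub_cancel, h2, h3, nsmul_eq_mul, smul_eq_mul, ← h4]
    ring
  have h := (hlim.comp tendsto_inv_nhdsGT_zero).const_mul 2
  have e : 2 * (-(eulerGamma + digammaFn (((M + 1 : ℕ) : ℝ) / 2)) / 2) =
      -(eulerGamma + digammaFn (((M + 1 : ℕ) : ℝ) / 2)) := by ring
  rw [e] at h
  refine h.congr' ?_
  filter_upwards [self_mem_nhdsWithin] with t ht
  rw [key t ht]
  simp only [Function.comp_apply, Real.log_inv]
  ring

/-- A function with a pointwise modulus `ω` such that `ω r / r` is integrable near the origin is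
uniformly continuous. -/
theorem uniformContinuous_of_dini {E : Type*} [PseudoMetricSpace E] {φ : E → ℝ} {ω : ℝ → ℝ}
    (hω : ∀ x y : E, ∀ r ∈ Ioc (0 : ℝ) 1, dist y x < r → |φ y - φ x| ≤ ω r)
    (hint : IntegrableOn (fun r => ω r / r) (Ioc 0 1)) : UniformContinuous φ := by
  rw [Metric.uniformContinuous_iff]
  by_contra! hcon
  obtain ⟨ε, hε, h⟩ := hcon
  have hlb : ∀ r ∈ Ioc (0 : ℝ) 1, ε ≤ ω r := by
    intro r hr
    obtain ⟨x, y, hxy, hd⟩ := h r hr.1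
    exact (Real.dist_eq _ _ ▸ hd).trans (hω y x r hr hxy)
  have h1 : IntegrableOn (fun r : ℝ => ε * r⁻¹) (Ioc 0 1) := by
    refine Integrable.mono' hint (by fun_prop) ?_
    filter_upwards [ae_restrict_mem measurableSet_Ioc] with r hr
    have := hr.1
    rw [Real.norm_of_nonneg (by positivity), div_eq_mul_inv]
    exact mul_le_mul_of_nonneg_right (hlb r hr) (by positivity)
  have h2 : IntegrableOn (fun r : ℝ => r⁻¹) (Ioc 0 1) := by
    refine (h1.const_mul ε⁻¹).congr (.of_forall fun r => ?_)
    field_simp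
  have h3 := (intervalIntegrable_iff_integrableOn_Ioc_of_le zero_le_one).mpr h2
  rw [intervalIntegrable_inv_iff] at h3
  simp at h3

/-- A bounded Dini continuous function has a monotone modulus of continuity `m` such that
`m r / r` is integrable near the origin. -/
theorem exists_dini_modulus {E : Type*} [NormedAddCommGroup E] [NormedSpace ℝ E] {φ : E → ℝ}
    {M : ℝ} (hM : ∀ x, |φ x| ≤ M) {ω : ℝ → ℝ}
    (hω : ∀ x y : E, ∀ r ∈ Ioc (0 : ℝ) 1, dist y x < r → |φ y - φ x| ≤ ω r)
    (hint : IntegrableOn (fun r => ω r / r) (Ioc 0 1)) :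
    ∃ m : ℝ → ℝ, (∀ x y, |φ (x + y) - φ x| ≤ m ‖y‖) ∧
      IntegrableOn (fun r => m r / r) (Ioo 0 1) := by
  have hcont := (uniformContinuous_of_dini hω hint).continuous
  have hω' : ∀ x y : E, ∀ r ∈ Ioc (0 : ℝ) 1, ‖y‖ ≤ r → |φ (x + y) - φ x| ≤ ω r := by
    intro x y r hr hy
    have hlim : Tendsto (fun s : ℝ => |φ (x + s • y) - φ x|) (𝓝[<] 1) (𝓝 |φ (x + y) - φ x|) := by
      have : Continuous fun s : ℝ => |φ (x + s • y) - φ x| := by fun_prop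
      simpa using (this.tendsto 1).mono_left nhdsWithin_le_nhds
    refine le_of_tendsto hlim ?_
    filter_upwards [Ioo_mem_nhdsLT (zero_lt_one (α := ℝ))] with s hs
    refine hω _ _ r hr ?_
    rw [dist_eq_norm, add_sub_cancel_left, norm_smul, Real.norm_of_nonneg hs.1.le]
    calc s * ‖y‖ ≤ s * r := by gcongr; exact hs.1.le
      _ < r := by nlinarith [hs.2, hr.1]
  set S : ℝ → Set ℝ := fun r => {a | ∃ x y : E, ‖y‖ ≤ r ∧ a = |φ (x + y) - φ x|} with hS
  have hbdd : ∀ r, BddAbove (S r) := by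
    refine fun r => ⟨M + M, ?_⟩
    rintro a ⟨x, y, -, rfl⟩
    exact (abs_sub _ _).trans (add_le_add (hM _) (hM _))
  have hne : ∀ r, 0 ≤ r → (S r).Nonempty := fun r hr => ⟨_, 0, 0, by simpa using hr, rfl⟩
  have hle : ∀ x y, |φ (x + y) - φ x| ≤ sSup (S ‖y‖) := fun x y =>
    le_csSup (hbdd _) ⟨x, y, le_rfl, rfl⟩
  have hnn : ∀ r, 0 ≤ sSup (S r) := by
    refine fun r => Real.sSup_nonneg ?_
    rintro a ⟨x, y, -, rfl⟩
    exact abs_nonneg _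
  have hmono : Monotone fun r => sSup (S r) := by
    intro r s hrs
    rcases lt_or_ge r 0 with hr | hr
    · have : S r = ∅ := by
        refine eq_empty_of_forall_notMem ?_
        rintro a ⟨x, y, hy, -⟩
        exact absurd (norm_nonneg y) (by linarith)
      simpa [this] using hnn s
    · refine csSup_le_csSup (hbdd s) (hne r hr) ?_
      rintro a ⟨x, y, hy, rfl⟩
      exact ⟨x, y, hy.trans hrs, rfl⟩
  refine ⟨fun r => sSup (S r), hle, ?_⟩
  refine Integrable.mono' (hint.mono_set Ioo_subset_Ioc_self)
    (hmono.measurable.div measurable_id).aestronglyMeasurable ?_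
  filter_upwards [ae_restrict_mem measurableSet_Ioo] with r hr
  have hr0 := hr.1
  rw [Real.norm_of_nonneg (div_nonneg (hnn r) hr0.le)]
  refine div_le_div_of_nonneg_right ?_ hr0.le
  refine csSup_le (hne r hr0.le) ?_
  rintro a ⟨x, y, hy, rfl⟩
  exact hω' x y r ⟨hr0, hr.2.le⟩ hy

theorem integrableOn_unit_ball_of_dini {N : ℕ} (hN : 1 ≤ N) {m : ℝ → ℝ}
    (hm : IntegrableOn (fun r => m r / r) (Ioo 0 1)) :
    IntegrableOn (fun y : EuclideanSpace ℝ (Fin N) => m ‖y‖ * ‖y‖ ^ (-(N : ℝ))) (ball 0 1) := by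
  have : Nontrivial (EuclideanSpace ℝ (Fin N)) :=
    Module.nontrivial_of_finrank_pos (R := ℝ) (by simpa using Nat.pos_of_ne_zero (by omega))
  rw [integrableOn_fun_norm_addHaar volume (f := fun r => m r * r ^ (-(N : ℝ)))]
  refine hm.congr_fun (fun r hr => ?_) measurableSet_Ioo
  have hr0 := hr.1
  obtain ⟨M, rfl⟩ : ∃ M, N = M + 1 := ⟨N - 1, by omega⟩
  simp only [finrank_euclideanSpace, Fintype.card_fin, Nat.add_sub_cancel, smul_eq_mul,
    Real.rpow_neg hr0.le, Real.rpow_natCast]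
  field_simp
  ring

/-- The increment of `φ` at `x` inside the unit ball, and the value of `φ` outside of it. -/
def truncDiff {E : Type*} [NormedAddCommGroup E] (φ : E → ℝ) (x y : E) : ℝ :=
  φ (x + y) - (ball (0 : E) 1).indicator (fun _ => φ x) y

section TruncDiff

variable {N : ℕ} {φ : EuclideanSpace ℝ (Fin N) → ℝ} {m : ℝ → ℝ}

theorem measurable_truncDiff (hφ : Continuous φ) (x : EuclideanSpace ℝ (Fin N)) :
    Measurable (truncDiff φ x) :=
  (hφ.comp (continuous_const_add x)).measurable.sub (measurable_const.indicator measurableSet_ball)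

theorem integrable_truncDiff_bound (hN : 1 ≤ N) (hφ : Integrable φ)
    (hm : IntegrableOn (fun r => m r / r) (Ioo 0 1)) (x : EuclideanSpace ℝ (Fin N)) :
    Integrable fun y => (ball (0 : EuclideanSpace ℝ (Fin N)) 1).indicator
      (fun y => m ‖y‖ * ‖y‖ ^ (-(N : ℝ))) y + |φ (x + y)| :=
  ((integrable_indicator_iff measurableSet_ball).mpr (integrableOn_unit_ball_of_dini hN hm)).add
    (hφ.comp_add_left x).abs

theorem abs_truncDiff_mul_le (hφm : ∀ x y, |φ (x + y) - φ x| ≤ m ‖y‖)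
    (x y : EuclideanSpace ℝ (Fin N)) :
    |truncDiff φ x y| * ‖y‖ ^ (-(N : ℝ)) ≤ (ball (0 : EuclideanSpace ℝ (Fin N)) 1).indicator
      (fun y => m ‖y‖ * ‖y‖ ^ (-(N : ℝ))) y + |φ (x + y)| := by
  by_cases hy : y ∈ ball (0 : EuclideanSpace ℝ (Fin N)) 1
  · simp only [truncDiff, indicator_of_mem hy]
    have := mul_le_mul_of_nonneg_right (hφm x y)
      (Real.rpow_nonneg (norm_nonneg y) (-(N : ℝ)))
    linarith [abs_nonneg (φ (x + y))]
  · simp only [truncDiff, indicator_of_notMem hy, sub_zero, zero_add]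
    have h1 : 1 ≤ ‖y‖ := by simpa using hy
    exact mul_le_of_le_one_right (abs_nonneg _)
      (Real.rpow_le_one_of_one_le_of_nonpos h1 (by simp))

theorem abs_truncDiff_mul_poissonKernel_le (x y : EuclideanSpace ℝ (Fin N)) (t : ℝ) :
    |truncDiff φ x y * (‖y‖ ^ 2 + t ^ 2) ^ (-(N : ℝ) / 2)| ≤
      |truncDiff φ x y| * ‖y‖ ^ (-(N : ℝ)) := by
  rcases eq_or_ne y 0 with rfl | hy
  · simp [truncDiff]
  · rw [abs_mul, abs_of_nonneg (a := (_ : ℝ) ^ (_ : ℝ)) (by positivity)]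
    refine mul_le_mul_of_nonneg_left ?_ (abs_nonneg _)
    exact poissonKernel_le_of_le (norm_pos_iff.mpr hy) (by nlinarith [sq_nonneg t])

theorem integrable_truncDiff_mul (hN : 1 ≤ N) (hφc : Continuous φ) (hφ : Integrable φ)
    (hφm : ∀ x y, |φ (x + y) - φ x| ≤ m ‖y‖)
    (hm : IntegrableOn (fun r => m r / r) (Ioo 0 1)) (x : EuclideanSpace ℝ (Fin N)) :
    Integrable fun y => truncDiff φ x y * ‖y‖ ^ (-(N : ℝ)) := by
  refine (integrable_truncDiff_bound hN hφ hm x).mono'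
    ((measurable_truncDiff hφc x).mul (by fun_prop)).aestronglyMeasurable (.of_forall fun y => ?_)
  rw [Real.norm_eq_abs, abs_mul, abs_of_nonneg (a := (_ : ℝ) ^ (_ : ℝ)) (by positivity)]
  exact abs_truncDiff_mul_le hφm x y

theorem integrable_truncDiff_mul_poissonKernel (hN : 1 ≤ N) (hφc : Continuous φ)
    (hφ : Integrable φ) (hφm : ∀ x y, |φ (x + y) - φ x| ≤ m ‖y‖)
    (hm : IntegrableOn (fun r => m r / r) (Ioo 0 1)) (x : EuclideanSpace ℝ (Fin N)) (t : ℝ) :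
    Integrable fun y => truncDiff φ x y * (‖y‖ ^ 2 + t ^ 2) ^ (-(N : ℝ) / 2) :=
  (integrable_truncDiff_bound hN hφ hm x).mono'
    ((measurable_truncDiff hφc x).mul (by fun_prop)).aestronglyMeasurable
    (.of_forall fun y => (abs_truncDiff_mul_poissonKernel_le x y t).trans
      (abs_truncDiff_mul_le hφm x y))

/-- The integral of the truncated increments against the Poisson-type kernel is bounded
uniformly in the base point and in `t`. -/
theorem abs_integral_truncDiff_mul_poissonKernel_le (hN : 1 ≤ N) (hφ : Integrable φ)
    (hφm : ∀ x y, |φ (x + y) - φ x| ≤ m ‖y‖)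
    (hm : IntegrableOn (fun r => m r / r) (Ioo 0 1)) (x : EuclideanSpace ℝ (Fin N)) (t : ℝ) :
    |∫ y, truncDiff φ x y * (‖y‖ ^ 2 + t ^ 2) ^ (-(N : ℝ) / 2)| ≤
      (∫ y in ball (0 : EuclideanSpace ℝ (Fin N)) 1, m ‖y‖ * ‖y‖ ^ (-(N : ℝ))) + ∫ y, |φ y| := by
  have h := norm_integral_le_of_norm_le
    (f := fun y => truncDiff φ x y * (‖y‖ ^ 2 + t ^ 2) ^ (-(N : ℝ) / 2))
    (integrable_truncDiff_bound hN hφ hm x)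
    (.of_forall fun y => (abs_truncDiff_mul_poissonKernel_le x y t).trans
      (abs_truncDiff_mul_le hφm x y))
  rwa [Real.norm_eq_abs, integral_add ((integrable_indicator_iff measurableSet_ball).mpr
    (integrableOn_unit_ball_of_dini hN hm)) (hφ.comp_add_left x).abs,
    integral_indicator measurableSet_ball, integral_add_left_eq_self (fun y => |φ y|) x] at h

theorem tendsto_integral_truncDiff_mul_poissonKernel (hN : 1 ≤ N) (hφc : Continuous φ)
    (hφ : Integrable φ) (hφm : ∀ x y, |φ (x + y) - φ x| ≤ m ‖y‖)
    (hm : IntegrableOn (fun r => m r / r) (Ioo 0 1)) (x : EuclideanSpace ℝ (Fin N)) :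
    Tendsto (fun t : ℝ => ∫ y, truncDiff φ x y * (‖y‖ ^ 2 + t ^ 2) ^ (-(N : ℝ) / 2))
      (𝓝[>] 0) (𝓝 (∫ y, truncDiff φ x y * ‖y‖ ^ (-(N : ℝ)))) := by
  refine tendsto_integral_filter_of_dominated_convergence _
    (.of_forall fun t =>
      (integrable_truncDiff_mul_poissonKernel hN hφc hφ hφm hm x t).aestronglyMeasurable)
    (.of_forall fun t => .of_forall fun y => (abs_truncDiff_mul_poissonKernel_le x y t).trans
      (abs_truncDiff_mul_le hφm x y)) (integrable_truncDiff_bound hN hφ hm x)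
    (.of_forall fun y => ?_)
  rcases eq_or_ne y 0 with rfl | hy
  · simp [truncDiff]
  · have hy' : 0 < ‖y‖ := norm_pos_iff.mpr hy
    have e : ‖y‖ ^ (-(N : ℝ)) = (‖y‖ ^ 2 + 0 ^ 2) ^ (-(N : ℝ) / 2) := by
      rw [← Real.rpow_natCast ‖y‖ 2, zero_pow two_ne_zero, add_zero, ← Real.rpow_mul hy'.le]
      congr 1
      push_cast
      ring
    rw [e]
    have hc : ContinuousAt (fun t : ℝ => truncDiff φ x y * (‖y‖ ^ 2 + t ^ 2) ^ (-(N : ℝ) / 2)) 0 :=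
      continuousAt_const.mul
        (ContinuousAt.rpow_const (by fun_prop) (Or.inl (by positivity)))
    exact hc.tendsto.mono_left nhdsWithin_le_nhds

/-- The principal value in the logarithmic Laplacian and its far part combine into a single
absolutely convergent integral. -/
theorem eq_of_tendsto_principalValue (hN : 1 ≤ N) (hφc : Continuous φ)
    (hφ : Integrable φ) (hφm : ∀ x y, |φ (x + y) - φ x| ≤ m ‖y‖)
    (hm : IntegrableOn (fun r => m r / r) (Ioo 0 1)) {x : EuclideanSpace ℝ (Fin N)} {c L : ℝ}
    (hL : Tendsto (fun ε : ℝ => c * ∫ y in {y : EuclideanSpace ℝ (Fin N) | ε ≤ ‖y‖ ∧ ‖y‖ < 1},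
        (φ x - φ (x + y)) * ‖y‖ ^ (-(N : ℝ))) (𝓝[>] (0 : ℝ)) (𝓝 L)) :
    c * ∫ y, truncDiff φ x y * ‖y‖ ^ (-(N : ℝ)) =
      c * (∫ y in {y : EuclideanSpace ℝ (Fin N) | 1 ≤ ‖y‖}, φ (x + y) * ‖y‖ ^ (-(N : ℝ))) - L := by
  have hint := integrable_truncDiff_mul hN hφc hφ hφm hm x
  have hms : ∀ ε : ℝ, MeasurableSet {y : EuclideanSpace ℝ (Fin N) | ε ≤ ‖y‖ ∧ ‖y‖ < 1} :=
    fun ε => (measurableSet_le measurable_const measurable_norm).inter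
      (measurableSet_lt measurable_norm measurable_const)
  have hpv : Tendsto (fun ε : ℝ => ∫ y in {y : EuclideanSpace ℝ (Fin N) | ε ≤ ‖y‖ ∧ ‖y‖ < 1},
      truncDiff φ x y * ‖y‖ ^ (-(N : ℝ))) (𝓝[>] (0 : ℝ))
      (𝓝 (∫ y in ball 0 1, truncDiff φ x y * ‖y‖ ^ (-(N : ℝ)))) := by
    simp_rw [← integral_indicator measurableSet_ball, ← integral_indicator (hms _)]
    refine tendsto_integral_filter_of_dominated_convergence _
      (.of_forall fun ε => hint.aestronglyMeasurable.indicator (hms ε))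
      (.of_forall fun ε => .of_forall fun y => norm_indicator_le_norm_self _ _) hint.norm
      (.of_forall fun y => ?_)
    rcases eq_or_ne y 0 with rfl | hy
    · simp [truncDiff, indicator]
    · refine tendsto_const_nhds.congr' ?_
      filter_upwards [nhdsWithin_le_nhds (ge_mem_nhds (norm_pos_iff.mpr hy))] with ε hε
      simp [indicator, hε]
  have hpv' : L = -(c * ∫ y in ball 0 1, truncDiff φ x y * ‖y‖ ^ (-(N : ℝ))) := by
    refine tendsto_nhds_unique hL ((hpv.const_mul c).neg.congr fun ε => ?_)
    rw [← mul_neg, ← integral_neg]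
    congr 1
    refine setIntegral_congr_fun (hms ε) fun y hy => ?_
    have : y ∈ ball (0 : EuclideanSpace ℝ (Fin N)) 1 := by simpa using hy.2
    simp only [truncDiff, indicator_of_mem this]
    ring
  have hcompl : (ball (0 : EuclideanSpace ℝ (Fin N)) 1)ᶜ = {y | 1 ≤ ‖y‖} := by
    ext y
    simp
  have hfar : ∫ y in (ball (0 : EuclideanSpace ℝ (Fin N)) 1)ᶜ,
      truncDiff φ x y * ‖y‖ ^ (-(N : ℝ)) = ∫ y in {y | 1 ≤ ‖y‖}, φ (x + y) * ‖y‖ ^ (-(N : ℝ)) := by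
    rw [← hcompl]
    refine setIntegral_congr_fun measurableSet_ball.compl fun y hy => ?_
    simp only [truncDiff, indicator_of_notMem hy, sub_zero]
  rw [← integral_add_compl measurableSet_ball hint, hfar, hpv']
  ring

theorem poissonExt_add_mul_log (hN : 1 ≤ N) (hφc : Continuous φ)
    (hφ : Integrable φ) (hφm : ∀ x y, |φ (x + y) - φ x| ≤ m ‖y‖)
    (hm : IntegrableOn (fun r => m r / r) (Ioo 0 1)) (x : EuclideanSpace ℝ (Fin N))
    {t : ℝ} (ht : 0 < t) :
    poissonExt N φ x t + φ x * Real.log t =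
      (cN N * (∫ y, truncDiff φ x y * (‖y‖ ^ 2 + t ^ 2) ^ (-(N : ℝ) / 2)) +
        φ x * (cN N * (∫ y in ball (0 : EuclideanSpace ℝ (Fin N)) 1,
          (‖y‖ ^ 2 + t ^ 2) ^ (-(N : ℝ) / 2)) + 2 * Real.log t)) / 2 := by
  have h1 : (∫ y, φ y * (‖x - y‖ ^ 2 + t ^ 2) ^ (-(N : ℝ) / 2)) =
      ∫ y, φ (x + y) * (‖y‖ ^ 2 + t ^ 2) ^ (-(N : ℝ) / 2) := by
    rw [← integral_add_left_eq_self _ x]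
    simp
  have hK : IntegrableOn (fun y : EuclideanSpace ℝ (Fin N) =>
      (‖y‖ ^ 2 + t ^ 2) ^ (-(N : ℝ) / 2)) (ball 0 1) :=
    ((continuous_poissonKernel ht).continuousOn.integrableOn_compact
      (isCompact_closedBall 0 1)).mono_set ball_subset_closedBall
  have h2 : (∫ y, φ (x + y) * (‖y‖ ^ 2 + t ^ 2) ^ (-(N : ℝ) / 2)) =
      (∫ y, truncDiff φ x y * (‖y‖ ^ 2 + t ^ 2) ^ (-(N : ℝ) / 2)) +
        φ x * ∫ y in ball (0 : EuclideanSpace ℝ (Fin N)) 1,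
          (‖y‖ ^ 2 + t ^ 2) ^ (-(N : ℝ) / 2) := by
    rw [← integral_const_mul, ← integral_indicator measurableSet_ball, ← integral_add
      (integrable_truncDiff_mul_poissonKernel hN hφc hφ hφm hm x t)
      ((integrable_indicator_iff measurableSet_ball).mpr (hK.const_mul (φ x)))]
    refine integral_congr_ae (.of_forall fun y => ?_)
    by_cases hy : y ∈ ball (0 : EuclideanSpace ℝ (Fin N)) 1
    · simp only [truncDiff, indicator_of_mem hy]
      ring
    · simp only [truncDiff, indicator_of_notMem hy]
      ring
  rw [poissonExt, h1, h2]
  ring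

end TruncDiff

theorem HasCompactSupport.exists_one_le_eq_zero_of_lt_norm {E : Type*}
    [NormedAddCommGroup E] {φ : E → ℝ} (hφ : HasCompactSupport φ) :
    ∃ R : ℝ, 1 ≤ R ∧ ∀ y, R < ‖y‖ → φ y = 0 := by
  obtain ⟨R, hR⟩ := hφ.isCompact.isBounded.subset_closedBall 0
  refine ⟨max R 1, le_max_right _ _, fun y hy => image_eq_zero_of_notMem_tsupport fun h => ?_⟩
  have := hR h
  rw [mem_closedBall_zero_iff] at this
  exact absurd this (not_le.mpr ((le_max_left _ _).trans_lt hy))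

/-- Away from the support of `φ` the Poisson-type extension decays like `‖x‖ ^ (-N)`, uniformly
in `t`. -/
theorem abs_poissonExt_le {N : ℕ} {φ : EuclideanSpace ℝ (Fin N) → ℝ} (hφ : Integrable φ) {R : ℝ}
    (hR : 1 ≤ R) (hsupp : ∀ y, R < ‖y‖ → φ y = 0) {x : EuclideanSpace ℝ (Fin N)}
    (hx : 2 * R ≤ ‖x‖) (t : ℝ) :
    |poissonExt N φ x t| ≤
      |cN N / 2| * ((4 : ℝ) ^ N * ∫ y, |φ y|) * (1 + ‖x‖) ^ (-(N : ℝ)) := by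
  have hpos : 0 < 1 + ‖x‖ := by positivity
  have hk : ∀ y, |φ y * (‖x - y‖ ^ 2 + t ^ 2) ^ (-(N : ℝ) / 2)| ≤
      |φ y| * (4 ^ N * (1 + ‖x‖) ^ (-(N : ℝ))) := by
    intro y
    rcases lt_or_ge R ‖y‖ with hy | hy
    · simp [hsupp y hy]
    · have h1 : (1 + ‖x‖) / 4 ≤ ‖x - y‖ := by
        have := norm_sub_norm_le x y
        linarith
      rw [abs_mul, abs_of_nonneg (a := (_ : ℝ) ^ (_ : ℝ)) (by positivity)]
      refine mul_le_mul_of_nonneg_left ?_ (abs_nonneg _)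
      refine (poissonKernel_le_of_le (a := (1 + ‖x‖) / 4) (by positivity) ?_).trans_eq ?_
      · have : ((1 + ‖x‖) / 4) ^ 2 ≤ ‖x - y‖ ^ 2 := by gcongr
        linarith [sq_nonneg t]
      · rw [Real.div_rpow hpos.le (by norm_num), Real.rpow_neg (x := 4) (by norm_num),
          Real.rpow_natCast, div_inv_eq_mul, mul_comm]
  have h := norm_integral_le_of_norm_le
    (f := fun y => φ y * (‖x - y‖ ^ 2 + t ^ 2) ^ (-(N : ℝ) / 2))
    (hφ.abs.mul_const (4 ^ N * (1 + ‖x‖) ^ (-(N : ℝ)))) (.of_forall hk)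
  rw [integral_mul_const] at h
  rw [poissonExt, abs_mul, mul_assoc]
  refine mul_le_mul_of_nonneg_left (h.trans_eq ?_) (abs_nonneg _)
  ring

theorem exists_abs_poissonExt_add_mul_log_le {N : ℕ} (hN : 1 ≤ N)
    {φ : EuclideanSpace ℝ (Fin N) → ℝ} {m : ℝ → ℝ} (hφc : Continuous φ)
    (hφs : HasCompactSupport φ) (hφm : ∀ x y, |φ (x + y) - φ x| ≤ m ‖y‖)
    (hm : IntegrableOn (fun r => m r / r) (Ioo 0 1)) :
    ∃ C : ℝ, ∀ᶠ t in 𝓝[>] (0 : ℝ), ∀ x,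
      |poissonExt N φ x t + φ x * Real.log t| ≤ C * (1 + ‖x‖) ^ (-(N : ℝ)) := by
  have hφ : Integrable φ := hφc.integrable_of_hasCompactSupport hφs
  obtain ⟨M, hM⟩ := hφs.exists_bound_of_continuous hφc
  have hM0 : 0 ≤ M := (norm_nonneg _).trans (hM 0)
  obtain ⟨R, hR, hsupp⟩ := hφs.exists_one_le_eq_zero_of_lt_norm
  set κ := -(eulerGamma + digammaFn ((N : ℝ) / 2))
  set C₀ := (∫ y in ball (0 : EuclideanSpace ℝ (Fin N)) 1, m ‖y‖ * ‖y‖ ^ (-(N : ℝ))) +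
    ∫ y, |φ y|
  have hC₀0 : 0 ≤ C₀ := (abs_nonneg _).trans
    (abs_integral_truncDiff_mul_poissonKernel_le hN hφ hφm hm 0 0)
  set A := (cN N * C₀ + M * (|κ| + 1)) / 2 with hA
  have hc := cN_pos hN
  have hA0 : 0 ≤ A := by positivity
  set D := |cN N / 2| * ((4 : ℝ) ^ N * ∫ y, |φ y|)
  have hD0 : 0 ≤ D := mul_nonneg (abs_nonneg _)
    (mul_nonneg (by positivity) (integral_nonneg fun y => abs_nonneg _))
  refine ⟨D + A * (1 + 2 * R) ^ N, ?_⟩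
  filter_upwards [self_mem_nhdsWithin,
    (tendsto_integral_unit_ball_poissonKernel hN).abs.eventually
      (ge_mem_nhds (lt_add_one |κ|))] with t (ht : 0 < t) hκ x
  have hp : 0 ≤ (1 + ‖x‖) ^ (-(N : ℝ)) := by positivity
  rcases le_or_gt (2 * R) ‖x‖ with hx | hx
  · rw [hsupp x (by linarith), zero_mul, add_zero]
    refine (abs_poissonExt_le hφ hR hsupp hx t).trans ?_
    gcongr
    exact le_add_of_nonneg_right (by positivity)
  · have h1 : |poissonExt N φ x t + φ x * Real.log t| ≤ A := by
      rw [poissonExt_add_mul_log hN hφc hφ hφm hm x ht, abs_div, abs_two, hA]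
      refine div_le_div_of_nonneg_right ((abs_add_le _ _).trans ?_) zero_le_two
      rw [abs_mul, abs_mul (φ x), abs_of_pos hc]
      refine add_le_add (mul_le_mul_of_nonneg_left ?_ hc.le)
        (mul_le_mul (hM x) hκ (abs_nonneg _) hM0)
      exact abs_integral_truncDiff_mul_poissonKernel_le hN hφ hφm hm x t
    have h2 : 1 ≤ (1 + 2 * R) ^ N * (1 + ‖x‖) ^ (-(N : ℝ)) := by
      rw [Real.rpow_neg (by positivity), Real.rpow_natCast, ← div_eq_mul_inv,
        one_le_div (by positivity)]
      gcongr
    calc |poissonExt N φ x t + φ x * Real.log t| ≤ A * 1 := by rwa [mul_one]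
      _ ≤ A * ((1 + 2 * R) ^ N * (1 + ‖x‖) ^ (-(N : ℝ))) := by gcongr
      _ ≤ (D + A * (1 + 2 * R) ^ N) * (1 + ‖x‖) ^ (-(N : ℝ)) := by
        rw [add_mul, ← mul_assoc]
        exact le_add_of_nonneg_left (mul_nonneg hD0 hp)

theorem stronglyMeasurable_poissonExt {N : ℕ} {φ : EuclideanSpace ℝ (Fin N) → ℝ}
    (hφ : Continuous φ) {t : ℝ} (ht : 0 < t) :
    StronglyMeasurable fun x => poissonExt N φ x t := by
  have hc : Continuous fun p : EuclideanSpace ℝ (Fin N) × EuclideanSpace ℝ (Fin N) =>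
      φ p.2 * (‖p.1 - p.2‖ ^ 2 + t ^ 2) ^ (-(N : ℝ) / 2) :=
    (hφ.comp continuous_snd).mul
      ((continuous_poissonKernel ht).comp (continuous_fst.sub continuous_snd))
  exact (hc.stronglyMeasurable.integral_prod_right (ν := volume)).const_mul _

/-- The Poisson-type kernel is symmetric with respect to the duality pairing. -/
theorem integrable_and_integral_poissonExt_mul {N : ℕ} {u φ : EuclideanSpace ℝ (Fin N) → ℝ}
    (hu : MemL10 N u) (hφ : Continuous φ) (hφs : HasCompactSupport φ) {t : ℝ} (ht : 0 < t) :
    Integrable (fun x => poissonExt N u x t * φ x) ∧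
      Integrable (fun x => u x * poissonExt N φ x t) ∧
      ∫ x, poissonExt N u x t * φ x = ∫ x, u x * poissonExt N φ x t := by
  obtain ⟨R, hR, hsupp⟩ := hφs.exists_one_le_eq_zero_of_lt_norm
  have hφi : Integrable φ := hφ.integrable_of_hasCompactSupport hφs
  set f : EuclideanSpace ℝ (Fin N) × EuclideanSpace ℝ (Fin N) → ℝ := fun p =>
    φ p.1 * u p.2 * (‖p.1 - p.2‖ ^ 2 + t ^ 2) ^ (-(N : ℝ) / 2) with hf
  set a : ℝ := ((1 + R) / t + 1)⁻¹ with ha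
  have ha0 : 0 < a := by positivity
  have hint : Integrable f (volume.prod volume) := by
    refine ((hφi.abs.mul_prod hu.2).const_mul (a ^ (-(N : ℝ)))).mono' ?_ (.of_forall fun p => ?_)
    · refine ((hφi.aestronglyMeasurable.comp_fst).mul
        (hu.1.aestronglyMeasurable.comp_snd)).mul ?_
      exact ((continuous_poissonKernel ht).comp
        (continuous_fst.sub continuous_snd)).aestronglyMeasurable
    · rcases lt_or_ge R ‖p.1‖ with hp | hp
      · simp [hf, hsupp _ hp]
      · have hK : (‖p.1 - p.2‖ ^ 2 + t ^ 2) ^ (-(N : ℝ) / 2) ≤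
            a ^ (-(N : ℝ)) * (1 + ‖p.2‖) ^ (-(N : ℝ)) := by
          rw [← Real.mul_rpow ha0.le (by positivity)]
          refine poissonKernel_le_of_le (by positivity) ?_
          set s := √(‖p.1 - p.2‖ ^ 2 + t ^ 2) with hs
          have hss : s ^ 2 = ‖p.1 - p.2‖ ^ 2 + t ^ 2 := Real.sq_sqrt (by positivity)
          have hs1 : ‖p.1 - p.2‖ ≤ s := Real.le_sqrt_of_sq_le (by nlinarith [sq_nonneg t])
          have hs2 : t ≤ s := Real.le_sqrt_of_sq_le (by nlinarith [sq_nonneg ‖p.1 - p.2‖])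
          have h1 : ‖p.2‖ ≤ ‖p.1‖ + ‖p.1 - p.2‖ := by
            have := norm_sub_norm_le p.2 p.1
            rw [norm_sub_rev] at this
            linarith
          have h2 : 1 + R ≤ (1 + R) / t * s := by
            rw [div_mul_eq_mul_div, le_div_iff₀ ht]
            gcongr
          have h3 : a * (1 + ‖p.2‖) ≤ s := by
            rw [ha, inv_mul_le_iff₀ (by positivity)]
            linarith
          rw [← hss]
          gcongr
        rw [hf, Real.norm_eq_abs, abs_mul, abs_mul,
          abs_of_nonneg (a := (_ : ℝ) ^ (_ : ℝ)) (by positivity)]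
        calc |φ p.1| * |u p.2| * (‖p.1 - p.2‖ ^ 2 + t ^ 2) ^ (-(N : ℝ) / 2)
            ≤ |φ p.1| * |u p.2| * (a ^ (-(N : ℝ)) * (1 + ‖p.2‖) ^ (-(N : ℝ))) := by gcongr
          _ = a ^ (-(N : ℝ)) * (|φ p.1| * ((1 + ‖p.2‖) ^ (-(N : ℝ)) * |u p.2|)) := by ring
  have e1 : ∀ x, poissonExt N u x t * φ x = cN N / 2 * ∫ y, f (x, y) := by
    intro x
    rw [poissonExt, mul_assoc, ← integral_mul_const]
    congr 2
    ext y
    simp only [hf]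
    ring
  have e2 : ∀ y, u y * poissonExt N φ y t = cN N / 2 * ∫ x, f (x, y) := by
    intro y
    rw [poissonExt, mul_left_comm, ← integral_const_mul]
    congr 2
    ext x
    simp only [hf, norm_sub_rev y x]
    ring
  simp_rw [e1, e2]
  refine ⟨hint.integral_prod_left.const_mul _, hint.integral_prod_right.const_mul _, ?_⟩
  rw [integral_const_mul, integral_const_mul, integral_integral_swap (f := fun x y => f (x, y)) hint]

/-- distributional representation of `L_Δ u` tested against a
uniformly Dini continuous, compactly supported `φ`. Here `Lφ` is the pointwise
logarithmic Laplacian of `φ`, encoded by the hypothesis `hL` which says that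
`c_N P.V.∫_{B_1} (φ(x) − φ(x+y))|y|^{−N} dy` converges to
`Lφ(x) + c_N ∫_{|y|≥1} φ(x+y)|y|^{−N} dy − ρ_N φ(x)` for every `x`. -/
theorem stmt10 (N : ℕ) (hN : 1 ≤ N) (u : EuclideanSpace ℝ (Fin N) → ℝ)
    (hu : MemL10 N u)
    (φ : EuclideanSpace ℝ (Fin N) → ℝ) (hφc : HasCompactSupport φ)
    (hφDini : ∃ ω : ℝ → ℝ,
      (∀ (x y : EuclideanSpace ℝ (Fin N)), ∀ r ∈ Set.Ioc (0 : ℝ) 1,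
        dist y x < r → |φ y - φ x| ≤ ω r) ∧
      MeasureTheory.IntegrableOn (fun r => ω r / r) (Set.Ioc (0 : ℝ) 1) volume)
    (Lφ : EuclideanSpace ℝ (Fin N) → ℝ)
    (hL : ∀ x : EuclideanSpace ℝ (Fin N),
      Tendsto (fun ε : ℝ =>
          cN N * ∫ y in {y : EuclideanSpace ℝ (Fin N) | ε ≤ ‖y‖ ∧ ‖y‖ < 1},
            (φ x - φ (x + y)) * ‖y‖ ^ (-(N : ℝ)))
        (𝓝[>] (0 : ℝ))
        (𝓝 (Lφ x
          + cN N * (∫ y in {y : EuclideanSpace ℝ (Fin N) | 1 ≤ ‖y‖},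
              φ (x + y) * ‖y‖ ^ (-(N : ℝ)))
          - rhoN N * φ x))) :
    ∃ ℓ : ℝ,
      Tendsto (fun t : ℝ =>
          ∫ x, (poissonExt N u x t + u x * Real.log t) * φ x)
        (𝓝[>] (0 : ℝ)) (𝓝 ℓ) ∧
      (∫ x, u x * Lφ x)
        = 2 * (Real.log 2 - eulerGamma) * (∫ x, u x * φ x) - 2 * ℓ := by
  obtain ⟨ω, hω, hωint⟩ := hφDini
  have hcont := (uniformContinuous_of_dini hω hωint).continuous
  have hφi : Integrable φ := hcont.integrable_of_hasCompactSupport hφc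
  obtain ⟨M, hM⟩ := hφc.exists_bound_of_continuous hcont
  obtain ⟨m, hφm, hm⟩ := exists_dini_modulus hM hω hωint
  obtain ⟨C, hC⟩ := exists_abs_poissonExt_add_mul_log_le hN hcont hφc hφm hm
  have huφ : Integrable fun x => u x * φ x := by
    simpa [mul_comm] using hu.1.integrable_smul_left_of_hasCompactSupport hcont hφc
  set g : EuclideanSpace ℝ (Fin N) → ℝ := fun x =>
    (Real.log 2 - eulerGamma) * φ x - Lφ x / 2 with hg
  have hlim : ∀ x, Tendsto (fun t => poissonExt N φ x t + φ x * Real.log t)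
      (𝓝[>] 0) (𝓝 (g x)) := by
    intro x
    have h1 := ((tendsto_integral_truncDiff_mul_poissonKernel hN hcont hφi hφm hm x).const_mul
      (cN N)).add ((tendsto_integral_unit_ball_poissonKernel hN).const_mul (φ x))
    rw [eq_of_tendsto_principalValue hN hcont hφi hφm hm (hL x)] at h1
    have h2 := h1.div_const 2
    have e : ∀ a : ℝ, (a - (Lφ x + a - rhoN N * φ x) +
        φ x * -(eulerGamma + digammaFn ((N : ℝ) / 2))) / 2 = g x := by
      intro a
      simp only [hg, rhoN]
      ring
    rw [e] at h2
    refine h2.congr' ?_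
    filter_upwards [self_mem_nhdsWithin] with t ht
    exact (poissonExt_add_mul_log hN hcont hφi hφm hm x ht).symm
  have hbound : ∀ᶠ t in 𝓝[>] (0 : ℝ), ∀ x,
      ‖u x * (poissonExt N φ x t + φ x * Real.log t)‖ ≤
        C * ((1 + ‖x‖) ^ (-(N : ℝ)) * |u x|) := by
    filter_upwards [hC] with t ht x
    rw [norm_mul, Real.norm_eq_abs, Real.norm_eq_abs]
    calc |u x| * |poissonExt N φ x t + φ x * Real.log t|
        ≤ |u x| * (C * (1 + ‖x‖) ^ (-(N : ℝ))) := by gcongr; exact ht x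
      _ = C * ((1 + ‖x‖) ^ (-(N : ℝ)) * |u x|) := by ring
  have hmeas : ∀ᶠ t in 𝓝[>] (0 : ℝ), AEStronglyMeasurable
      (fun x => u x * (poissonExt N φ x t + φ x * Real.log t)) := by
    filter_upwards [self_mem_nhdsWithin] with t ht
    exact hu.1.aestronglyMeasurable.mul
      ((stronglyMeasurable_poissonExt hcont ht).aestronglyMeasurable.add
        (hφi.aestronglyMeasurable.mul_const _))
  have hulim : ∀ x, Tendsto (fun t => u x * (poissonExt N φ x t + φ x * Real.log t))
      (𝓝[>] 0) (𝓝 (u x * g x)) := fun x => (hlim x).const_mul _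
  have hmain := tendsto_integral_filter_of_dominated_convergence _ hmeas
    (hbound.mono fun t ht => .of_forall ht) (hu.2.const_mul C) (.of_forall hulim)
  have hseq : Tendsto (fun n : ℕ => 1 / ((n : ℝ) + 1)) atTop (𝓝[>] 0) :=
    tendsto_nhdsWithin_iff.mpr ⟨tendsto_one_div_add_atTop_nhds_zero_nat,
      .of_forall fun n => mem_Ioi.mpr Nat.one_div_pos_of_nat⟩
  have hgmeas : AEStronglyMeasurable g :=
    aestronglyMeasurable_of_tendsto_ae atTop
      (fun n : ℕ => (stronglyMeasurable_poissonExt hcont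
        (Nat.one_div_pos_of_nat (n := n))).aestronglyMeasurable.add
          (hφi.aestronglyMeasurable.mul_const _))
      (.of_forall fun x => (hlim x).comp hseq)
  have hug : Integrable fun x => u x * g x := by
    refine (hu.2.const_mul C).mono' (hu.1.aestronglyMeasurable.mul hgmeas) (.of_forall fun x => ?_)
    exact le_of_tendsto (hulim x).norm (hbound.mono fun t ht => ht x)
  refine ⟨∫ x, u x * g x, hmain.congr' ?_, ?_⟩
  · filter_upwards [self_mem_nhdsWithin] with t ht
    obtain ⟨h1, h2, h3⟩ := integrable_and_integral_poissonExt_mul hu hcont hφc ht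
    have h4 := huφ.mul_const (Real.log t)
    calc ∫ x, u x * (poissonExt N φ x t + φ x * Real.log t)
        = ∫ x, (u x * poissonExt N φ x t + u x * φ x * Real.log t) := by
          simp only [mul_add, mul_assoc]
      _ = ∫ x, (poissonExt N u x t * φ x + u x * φ x * Real.log t) := by
          rw [integral_add h2 h4, integral_add h1 h4, h3]
      _ = ∫ x, (poissonExt N u x t + u x * Real.log t) * φ x := by
          congr 1
          ext x
          ring
  · rw [← integral_const_mul, ← integral_const_mul,
      ← integral_sub (huφ.const_mul _) (hug.const_mul _)]
    congr 1
    ext x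
    simp only [hg]
    ring
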